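/- arXiv:2605.07787 — 2 statements merged into one kernel-verified Lean document; each statement's English description precedes it below -/
import Mathlib

section
/- Let n ≥ 1 and A ∈ Mₙ(ℍ). Then the following are equivalent: (i) for every vector ξ ∈ ℍⁿ the quaternion ∑_{k,ℓ} conj(ξ_k)·A_{kℓ}·ξ_ℓ is a nonnegative real number (i.e. equals the quaternion (r : ℍ) for some real r ≥ 0); (ii) the complex matrix χₙ(A) ∈ M_{2n}(ℂ) is positive semidefinite. -/
open Matrix
open scoped Quaternion ComplexOrder

/-- The extension of the standard embedding `χ` to quaternionic `n × n` matrices: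
writing `A = A₁ + A₂·j` entrywise with `A₁, A₂` complex matrices,
`χₙ(A) = [[A₁, A₂], [−conj A₂, conj A₁]]` as a `2 × 2` block matrix. -/
noncomputable def chiN {n : ℕ} (A : Matrix (Fin n) (Fin n) ℍ[ℝ]) :
    Matrix (Fin n ⊕ Fin n) (Fin n ⊕ Fin n) ℂ :=
  Matrix.fromBlocks
    (Matrix.of fun k ℓ => (⟨(A k ℓ).re, (A k ℓ).imI⟩ : ℂ))
    (Matrix.of fun k ℓ => (⟨(A k ℓ).imJ, (A k ℓ).imK⟩ : ℂ))
    (-(Matrix.of fun k ℓ => (starRingEnd ℂ (⟨(A k ℓ).imJ, (A k ℓ).imK⟩ : ℂ))))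
    (Matrix.of fun k ℓ => (starRingEnd ℂ (⟨(A k ℓ).re, (A k ℓ).imI⟩ : ℂ)))

/-- The first complex coordinate `p₁` of a quaternion `p = p₁ + p₂·j`, as an additive map. -/
def quaternionFstHom : ℍ[ℝ] →+ ℂ where
  toFun q := ⟨q.re, q.imI⟩
  map_zero' := rfl
  map_add' _ _ := rfl

@[simp]
theorem quaternionFstHom_apply (q : ℍ[ℝ]) : quaternionFstHom q = ⟨q.re, q.imI⟩ := rfl

/-- The first column `(ξ₁, −conj ξ₂)` of the complex representation of a quaternionic vector
`ξ = ξ₁ + ξ₂·j`. -/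
def chiColumn {n : ℕ} (ξ : Fin n → ℍ[ℝ]) : Fin n ⊕ Fin n → ℂ :=
  Sum.elim (fun k => ⟨(ξ k).re, (ξ k).imI⟩) (fun k => ⟨-(ξ k).imJ, (ξ k).imK⟩)

theorem chiColumn_surjective {n : ℕ} :
    Function.Surjective (chiColumn : (Fin n → ℍ[ℝ]) → Fin n ⊕ Fin n → ℂ) := by
  intro v
  refine ⟨fun k => ⟨(v (.inl k)).re, (v (.inl k)).im, -(v (.inr k)).re, (v (.inr k)).im⟩, ?_⟩
  ext (k | k) <;> simp [chiColumn]

theorem star_chiColumn_dotProduct_chiN_mulVec {n : ℕ} (A : Matrix (Fin n) (Fin n) ℍ[ℝ])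
    (ξ : Fin n → ℍ[ℝ]) :
    star (chiColumn ξ) ⬝ᵥ (chiN A *ᵥ chiColumn ξ) =
      quaternionFstHom (∑ k, ∑ ℓ, star (ξ k) * A k ℓ * ξ ℓ) := by
  simp only [dotProduct, mulVec, map_sum, Fintype.sum_sum_type, Finset.mul_sum, mul_add,
    ← Finset.sum_add_distrib]
  refine Finset.sum_congr rfl fun k _ => Finset.sum_congr rfl fun ℓ _ => ?_
  apply Complex.ext <;> simp [chiN, chiColumn] <;> ring

theorem posSemidef_of_complex_dotProduct_mulVec_nonneg {m : Type*} [Fintype m]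
    {M : Matrix m m ℂ} (h : ∀ x, 0 ≤ star x ⬝ᵥ (M *ᵥ x)) : M.PosSemidef := by
  classical
  rw [← Matrix.isPositive_toEuclideanLin_iff, LinearMap.isPositive_iff_complex]
  intro x
  have hx := h x.ofLp
  have hinner : inner ℂ (M.toEuclideanLin x) x = star (star x.ofLp ⬝ᵥ (M *ᵥ x.ofLp)) := by
    rw [EuclideanSpace.inner_eq_star_dotProduct, Matrix.ofLp_toLpLin, Matrix.toLin'_apply,
      Matrix.star_dotProduct, dotProduct_comm]
    simp
  rw [hinner]
  obtain ⟨hre, him⟩ := Complex.nonneg_iff.mp hx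
  exact ⟨by apply Complex.ext <;> simp [← him], by simpa using hre⟩

theorem isHermitian_of_isHermitian_chiN {n : ℕ} {A : Matrix (Fin n) (Fin n) ℍ[ℝ]}
    (h : (chiN A).IsHermitian) : A.IsHermitian := by
  ext k ℓ
  all_goals
    have h₁ := h.apply (.inl k) (.inl ℓ)
    have h₂ := h.apply (.inl k) (.inr ℓ)
    simp [chiN, Complex.ext_iff] at h₁ h₂
    simp
    linarith

theorem star_sum_star_mul_mul {n : ℕ} {A : Matrix (Fin n) (Fin n) ℍ[ℝ]} (hA : A.IsHermitian)
    (ξ : Fin n → ℍ[ℝ]) :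
    star (∑ k, ∑ ℓ, star (ξ k) * A k ℓ * ξ ℓ) = ∑ k, ∑ ℓ, star (ξ k) * A k ℓ * ξ ℓ := by
  simp only [star_sum, star_mul, star_star, hA.apply, mul_assoc]
  exact Finset.sum_comm

/-- A quaternionic matrix `A` is positive semidefinite (in the sense that every quadratic
form value `∑ conj(ξ_k)·A_{kℓ}·ξ_ℓ` is a nonnegative real number) if and only if the
complex matrix `χₙ(A)` is positive semidefinite. -/
theorem quaternionic_posSemidef_iff_chiN_posSemidef
    (n : ℕ) (hn : 1 ≤ n) (A : Matrix (Fin n) (Fin n) ℍ[ℝ]) :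
    (∀ ξ : Fin n → ℍ[ℝ], ∃ r : ℝ, 0 ≤ r ∧
        ∑ k, ∑ ℓ, star (ξ k) * A k ℓ * ξ ℓ = (r : ℍ[ℝ])) ↔
      (chiN A).PosSemidef := by
  constructor
  · intro h
    refine posSemidef_of_complex_dotProduct_mulVec_nonneg fun v => ?_
    obtain ⟨ξ, rfl⟩ := chiColumn_surjective v
    obtain ⟨r, hr, hξ⟩ := h ξ
    rw [star_chiColumn_dotProduct_chiN_mulVec, hξ]
    exact Complex.nonneg_iff.mpr ⟨hr, rfl⟩
  · intro h ξ
    have hξ := h.dotProduct_mulVec_nonneg (chiColumn ξ)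
    rw [star_chiColumn_dotProduct_chiN_mulVec] at hξ
    exact ⟨_, (Complex.nonneg_iff.mp hξ).1, Quaternion.star_eq_self.mp
      (star_sum_star_mul_mul (isHermitian_of_isHermitian_chiN h.isHermitian) ξ)⟩
end

section
/- Let p, γ, A, B, C, D ∈ ℍ with ‖γ‖ < 1, let r := √(1 − ‖γ‖²), and define A' := r⁻¹·(A·p − conj(γ)·D), B' := r⁻¹·(B − p·C·γ), C' := r⁻¹·(p·C − B·conj(γ)), D' := r⁻¹·(D − γ·A·p) (here r⁻¹ is a real scalar). Then ‖B'‖² + ‖D'‖² − ‖A'‖² − ‖C'‖² = ‖B‖² + ‖D‖² − ‖p‖²·(‖A‖² + ‖C‖²). -/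
open scoped Quaternion

/-- Right multiplication form of the quaternionic `SU(1,1)`-type norm identity. -/
theorem Quaternion.norm_sub_mul_sq_sub_norm_sub_mul_star_sq (b x g : ℍ[ℝ]) :
    ‖b - x * g‖ ^ 2 - ‖x - b * star g‖ ^ 2 = (1 - ‖g‖ ^ 2) * (‖b‖ ^ 2 - ‖x‖ ^ 2) := by
  simp only [sq, ← Quaternion.normSq_eq_norm_mul_self, Quaternion.normSq_def',
    Quaternion.re_sub, Quaternion.imI_sub, Quaternion.imJ_sub, Quaternion.imK_sub,
    Quaternion.re_mul, Quaternion.imI_mul, Quaternion.imJ_mul, Quaternion.imK_mul,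
    Quaternion.re_star, Quaternion.imI_star, Quaternion.imJ_star, Quaternion.imK_star]
  ring

/-- Left multiplication form of the quaternionic `SU(1,1)`-type norm identity. -/
theorem Quaternion.norm_sub_mul_sq_sub_norm_sub_star_mul_sq (d y g : ℍ[ℝ]) :
    ‖d - g * y‖ ^ 2 - ‖y - star g * d‖ ^ 2 = (1 - ‖g‖ ^ 2) * (‖d‖ ^ 2 - ‖y‖ ^ 2) := by
  have h := norm_sub_mul_sq_sub_norm_sub_mul_star_sq (star d) (star y) (star g)
  simpa only [← star_mul, ← star_sub, norm_star] using h

/-- The one-step computation at the heart of the diagonal Christoffel–Darboux formula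
(Theorem 7.1 of the paper): if `A', B', C', D'` are obtained from `A, B, C, D` by one
step of the quaternionic Szegő recurrences with Verblunsky coefficient `γ` (with
`r = √(1 − ‖γ‖²)`), then
`‖B'‖² + ‖D'‖² − ‖A'‖² − ‖C'‖² = ‖B‖² + ‖D‖² − ‖p‖²·(‖A‖² + ‖C‖²)`. -/
theorem diagonal_christoffel_darboux_step
    (p γ A B C D : ℍ[ℝ]) (hγ : ‖γ‖ < 1) :
    ‖(Real.sqrt (1 - ‖γ‖ ^ 2))⁻¹ • (B - p * C * γ)‖ ^ 2 +
        ‖(Real.sqrt (1 - ‖γ‖ ^ 2))⁻¹ • (D - γ * A * p)‖ ^ 2 -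
        ‖(Real.sqrt (1 - ‖γ‖ ^ 2))⁻¹ • (A * p - star γ * D)‖ ^ 2 -
        ‖(Real.sqrt (1 - ‖γ‖ ^ 2))⁻¹ • (p * C - B * star γ)‖ ^ 2 =
      ‖B‖ ^ 2 + ‖D‖ ^ 2 - ‖p‖ ^ 2 * (‖A‖ ^ 2 + ‖C‖ ^ 2) := by
  have hg : 0 < 1 - ‖γ‖ ^ 2 := by
    have := norm_nonneg γ
    nlinarith
  have hB := Quaternion.norm_sub_mul_sq_sub_norm_sub_mul_star_sq B (p * C) γ
  have hD := Quaternion.norm_sub_mul_sq_sub_norm_sub_star_mul_sq D (A * p) γ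
  rw [← mul_assoc, norm_mul A p] at hD
  rw [norm_mul p C] at hB
  simp only [norm_smul, mul_pow, norm_inv, inv_pow, Real.norm_eq_abs, sq_abs,
    Real.sq_sqrt hg.le]
  field_simp
  linear_combination hB + hD
end
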